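/- arXiv:1704.00882 — 3 statements merged into one kernel-verified Lean document; each statement's English description precedes it below -/
import Mathlib

section
/- Let m ≥ 0 and n > 1. The number of partitions λ of n such that (writing j = j_m(λ)) rank(λ) ≥ −m+1, j ≥ 1 and λ_{m+j+1} = j−1, is at most the number of partitions μ of n such that (writing j' = j_m(μ)) j' ≥ 1, μ_{m+j'+1} = j', rank(μ) ≤ −m, and the number of parts of μ that are greater than j' is strictly less than m + j'. -/
open scoped BigOperators

namespace RankCrank

/-- The `i`-th largest part of a partition (1-indexed); `0` if `i` exceeds
the number of parts. -/
def part {n : ℕ} (l : n.Partition) (i : ℕ) : ℕ :=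
  ((l.parts.sort (· ≤ ·)).reverse).getD (i - 1) 0

/-- The rank of a partition: largest part minus number of parts. -/
def rank {n : ℕ} (l : n.Partition) : ℤ :=
  (part l 1 : ℤ) - l.parts.card

/-- The crank of a partition: the largest part if there are no parts equal to 1,
otherwise the number of parts larger than the number of 1's minus the number of 1's. -/
def crank {n : ℕ} (l : n.Partition) : ℤ :=
  if l.parts.count 1 = 0 then (part l 1 : ℤ)
  else ((l.parts.filter (fun x => l.parts.count 1 < x)).card : ℤ) - l.parts.count 1

/-- `N m n` is the number of partitions of `n` with rank `m`. -/
noncomputable def N (m : ℤ) (n : ℕ) : ℕ :=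
  Nat.card {l : n.Partition // rank l = m}

/-- `M m n` is the number of partitions of `n` with crank `m` for `n ≠ 1`, with the
usual convention for `n = 1`. -/
noncomputable def M (m : ℤ) (n : ℕ) : ℤ :=
  if n = 1 then (if m = 0 then -1 else if m = 1 ∨ m = -1 then 1 else 0)
  else (Nat.card {l : n.Partition // crank l = m} : ℤ)

/-- `Nle m n = N(≤ m, n) = ∑_{r ≤ m} N(r,n)`; since `N(r,n) = 0` for `r < -n`,
the sum may be taken over `-n ≤ r ≤ m`. -/
noncomputable def Nle (m : ℤ) (n : ℕ) : ℤ :=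
  ∑ r ∈ Finset.Icc (-(n : ℤ)) m, (N r n : ℤ)

/-- `Mle m n = M(≤ m, n) = ∑_{r ≤ m} M(r,n)`; since `M(r,n) = 0` for `r < -n`,
the sum may be taken over `-n ≤ r ≤ m`. -/
noncomputable def Mle (m : ℤ) (n : ℕ) : ℤ :=
  ∑ r ∈ Finset.Icc (-(n : ℤ)) m, M r n

/-- The number of partitions of `n`. -/
noncomputable def p (n : ℕ) : ℕ := Nat.card n.Partition

/-- `ospt n = ∑_{m ≥ 0} m M(m,n) - ∑_{m ≥ 0} m N(m,n)`; since ranks and cranks of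
partitions of `n` are at most `n`, the sums may be taken over `0 ≤ m ≤ n`. -/
noncomputable def ospt (n : ℕ) : ℤ :=
  (∑ m ∈ Finset.Icc (0 : ℤ) (n : ℤ), m * M m n) -
    (∑ m ∈ Finset.Icc (0 : ℤ) (n : ℤ), m * (N m n : ℤ))

/-- The rank-set of a partition `λ`:  `{j - λ_{j+1} : 0 ≤ j ≤ ℓ-1} ∪ {j : j ≥ ℓ}`
(note `part l (j+1) = 0` for `j ≥ ℓ`). -/
def rankSet {n : ℕ} (l : n.Partition) : Set ℤ :=
  {x | ∃ j : ℕ, x = (j : ℤ) - (part l (j + 1) : ℤ)}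

/-- `q m n` is the number of partitions of `n` whose rank-set contains `m`. -/
noncomputable def q (m : ℤ) (n : ℕ) : ℕ :=
  Nat.card {l : n.Partition // m ∈ rankSet l}

/-- `prank m n` is the number of partitions of `n` with rank at least `m`. -/
noncomputable def prank (m : ℤ) (n : ℕ) : ℕ :=
  Nat.card {l : n.Partition // m ≤ rank l}

/-- `jm m l` is the number of columns of the `m`-Durfee rectangle of `l`: the largest
`j ≥ 0` with `λ_{m+j} ≥ j`. -/
noncomputable def jm {n : ℕ} (m : ℕ) (l : n.Partition) : ℕ :=
  sSup {j : ℕ | j ≤ part l (m + j)}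

/-- The total number of smallest parts in all partitions of `n`. -/
def spt (n : ℕ) : ℕ :=
  ∑ l : n.Partition, l.parts.count ((l.parts.sort (· ≤ ·)).headD 0)

/-- A bijection `τ` on partitions of `n` nearly preserves the rank–crank
distribution if `crank λ - rank (τ λ)` is `0` when `crank λ = 0`, is `0` or `1`
when `crank λ > 0`, and is `0` or `-1` when `crank λ < 0`. -/
def NearlyPreserves {n : ℕ} (τ : n.Partition ≃ n.Partition) : Prop :=
  ∀ l : n.Partition,
    (crank l = 0 → crank l - rank (τ l) = 0) ∧
    (0 < crank l → crank l - rank (τ l) = 0 ∨ crank l - rank (τ l) = 1) ∧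
    (crank l < 0 → crank l - rank (τ l) = 0 ∨ crank l - rank (τ l) = -1)

end RankCrank

namespace RankCrank

lemma reverse_sort_eq {n : ℕ} (l : n.Partition) {L : List ℕ} (hL : L.Pairwise (· ≥ ·))
    (h : (L : Multiset ℕ) = l.parts) : (l.parts.sort (· ≤ ·)).reverse = L := by
  have hp : (l.parts.sort (· ≤ ·)).reverse.Perm L := by
    rw [← Multiset.coe_eq_coe, Multiset.coe_reverse, Multiset.sort_eq, h]
  refine hp.eq_of_pairwise (fun a b _ _ h₁ h₂ => le_antisymm h₂ h₁) ?_ hL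
  rw [List.pairwise_reverse]
  exact Multiset.pairwise_sort _ _

lemma exists_sorted_list {n : ℕ} (l : n.Partition) :
    ∃ L : List ℕ, L.Pairwise (· ≥ ·) ∧ (L : Multiset ℕ) = l.parts :=
  ⟨(l.parts.sort (· ≤ ·)).reverse, by
    rw [List.pairwise_reverse]; exact Multiset.pairwise_sort _ _, by
    rw [Multiset.coe_reverse, Multiset.sort_eq]⟩

lemma part_eq_getD {n : ℕ} (l : n.Partition) {L : List ℕ} (hL : L.Pairwise (· ≥ ·))
    (h : (L : Multiset ℕ) = l.parts) (i : ℕ) : part l i = L.getD (i - 1) 0 := by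
  rw [part, reverse_sort_eq l hL h]

lemma part_antitone {n : ℕ} (l : n.Partition) : Antitone (part l) := by
  obtain ⟨L, hL, h⟩ := exists_sorted_list l
  intro a b hab
  rw [part_eq_getD l hL h, part_eq_getD l hL h]
  rcases lt_or_ge (b - 1) L.length with hb | hb
  · have ha : a - 1 < L.length := by omega
    rw [List.getD_eq_getElem _ _ ha, List.getD_eq_getElem _ _ hb]
    rcases Nat.eq_or_lt_of_le (show a - 1 ≤ b - 1 by omega) with e | e
    · simp [e]
    · exact List.pairwise_iff_getElem.1 hL _ _ ha hb e
  · simp [List.getElem?_eq_none hb]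

lemma jm_le_part {n : ℕ} (m : ℕ) (l : n.Partition) : jm m l ≤ part l (m + jm m l) := by
  refine Nat.sSup_mem (s := {j : ℕ | j ≤ part l (m + j)}) ⟨0, by simp⟩ ⟨part l 0, ?_⟩
  exact fun j hj => le_trans hj (part_antitone l (Nat.zero_le _))

lemma jm_eq {n : ℕ} {m j : ℕ} {l : n.Partition} (h₁ : j ≤ part l (m + j))
    (h₂ : part l (m + j + 1) ≤ j) : jm m l = j := by
  refine IsGreatest.csSup_eq ⟨h₁, fun k hk => ?_⟩
  by_contra! hlt
  have := part_antitone l (show m + j + 1 ≤ m + k by omega)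
  have hk : k ≤ part l (m + k) := hk
  omega

/-- In terms of the `m`-Durfee rectangle, delete a column of height one from below the rectangle
and put it back as a new first row on its right. -/
noncomputable def columnToRow {n : ℕ} (m : ℕ) (l : n.Partition) : Multiset ℕ :=
  let L := (l.parts.sort (· ≤ ·)).reverse
  (((L.length - m) :: (L.take (m + jm m l - 1) ++
    ((L.drop (m + jm m l)).map (· - 1)).filter (· ≠ 0)) : List ℕ) : Multiset ℕ)

lemma exists_partition_of_append {n m j x : ℕ} {mid tail : List ℕ} (l : n.Partition)
    (hj : 1 ≤ j) (hlen : mid.length + 1 = m + j)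
    (hL : (x :: (mid ++ tail)).Pairwise (· ≥ ·))
    (hl : ((x :: (mid ++ tail) : List ℕ) : Multiset ℕ) = l.parts)
    (hjx : j ≤ x) (hmid : ∀ y ∈ mid, j ≤ y) (htail : tail.getD 0 0 = j - 1)
    (hx : tail.length + 1 + j ≤ x) :
    ∃ μ : n.Partition, (1 ≤ jm m μ ∧ part μ (m + jm m μ + 1) = jm m μ ∧ rank μ ≤ -(m : ℤ) ∧
      (μ.parts.filter (fun x => jm m μ < x)).card < m + jm m μ) ∧
      columnToRow m μ = l.parts := by
  have hpos : ∀ y ∈ x :: (mid ++ tail), 0 < y := fun y hy =>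
    l.parts_pos (by rw [← hl]; exact hy)
  have hsum : (x :: (mid ++ tail)).sum = n := by
    rw [← l.parts_sum, ← hl, Multiset.sum_coe]
  obtain ⟨hxge, hmt⟩ := List.pairwise_cons.1 hL
  obtain ⟨hm, ht, -⟩ := List.pairwise_append.1 hmt
  have htle : ∀ y ∈ tail, y + 1 ≤ j := by
    intro y hy
    cases tail with
    | nil => simp at hy
    | cons z t =>
      simp only [List.getD_cons_zero] at htail
      rcases List.mem_cons.1 hy with rfl | hy
      · omega
      · have := (List.pairwise_cons.1 ht).1 y hy
        omega
  set k := x - j - tail.length with hk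
  set bot := tail.map (· + 1) ++ List.replicate k 1 with hbot
  have hbotle : ∀ y ∈ bot, y ≤ j := by
    intro y hy
    simp only [hbot, List.mem_append, List.mem_map, List.mem_replicate] at hy
    rcases hy with ⟨z, hz, rfl⟩ | ⟨-, rfl⟩
    · exact htle z hz
    · exact hj
  have hbotpos : ∀ y ∈ bot, 0 < y := by
    intro y hy
    simp only [hbot, List.mem_append, List.mem_map, List.mem_replicate] at hy
    rcases hy with ⟨z, hz, rfl⟩ | ⟨-, rfl⟩ <;> omega
  have hbotsorted : bot.Pairwise (· ≥ ·) := by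
    rw [hbot, List.pairwise_append]
    refine ⟨?_, ?_, ?_⟩
    · rw [List.pairwise_map]
      exact ht.imp (fun h => Nat.succ_le_succ h)
    · simp [List.pairwise_replicate]
    · intro a ha b hb
      rw [List.mem_map] at ha
      obtain ⟨z, -, rfl⟩ := ha
      have := List.eq_of_mem_replicate hb
      omega
  have hbothead : bot.getD 0 0 = j := by
    rw [hbot]
    cases tail with
    | nil =>
      obtain ⟨k', hk'⟩ : ∃ k', k = k' + 1 := ⟨k - 1, by simp at hx hk; omega⟩
      rw [hk']
      simp [List.replicate_succ] at htail ⊢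
      omega
    | cons z t => simp at htail ⊢; omega
  have hbotlen : bot.length = x - j := by simp [hbot]; omega
  have hbotsum : bot.sum = tail.sum + (x - j) := by
    have : (tail.map (· + 1)).sum = tail.sum + tail.length := by
      simp [List.sum_map_add]
    simp [hbot, this]; omega
  set M := mid ++ j :: bot with hM
  have hMsorted : M.Pairwise (· ≥ ·) := by
    rw [hM, List.pairwise_append, List.pairwise_cons]
    refine ⟨hm, ⟨hbotle, hbotsorted⟩, fun a ha b hb => ?_⟩
    have := hmid a ha
    rcases List.mem_cons.1 hb with rfl | hb
    · exact this
    · exact (hbotle b hb).trans this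
  have hMlen : M.length = m + x := by simp [hM, hbotlen]; omega
  have hMle : ∀ y ∈ M, y ≤ x := by
    intro y hy
    rcases List.mem_append.1 hy with hy | hy
    · exact hxge y (List.mem_append_left _ hy)
    · rcases List.mem_cons.1 hy with rfl | hy
      · exact hjx
      · exact (hbotle y hy).trans hjx
  let μ : n.Partition :=
    { parts := M
      parts_pos := by
        intro y hy
        have hy : y ∈ M := hy
        rcases List.mem_append.1 hy with hy | hy
        · exact hpos y (by simp [hy])
        · rcases List.mem_cons.1 hy with rfl | hy
          · exact hj
          · exact hbotpos y hy
      parts_sum := by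
        rw [Multiset.sum_coe, hM, ← hsum]
        simp [hbotsum]; omega }
  have hμ : (M : Multiset ℕ) = μ.parts := rfl
  have hpart := part_eq_getD μ hMsorted hμ
  have hp₁ : part μ (m + j) = j := by
    rw [hpart, ← hlen, hM]; simp
  have hp₂ : part μ (m + j + 1) = j := by
    rw [hpart, ← hlen, hM, ← hbothead]
    simp [List.getElem?_append_right]
  have hjm : jm m μ = j := jm_eq hp₁.ge hp₂.le
  refine ⟨μ, ⟨?_, ?_, ?_, ?_⟩, ?_⟩
  · rwa [hjm]
  · rw [hjm, hp₂]
  · have h1 : part μ 1 ≤ x := by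
      rw [hpart, List.getD_eq_getElem _ _ (by omega)]
      exact hMle _ (List.getElem_mem _)
    have h2 : μ.parts.card = m + x := by rw [← hμ, Multiset.coe_card, hMlen]
    rw [rank, h2]
    push_cast
    omega
  · rw [hjm, ← hμ, Multiset.filter_coe, Multiset.coe_card, hM, List.filter_append]
    have : (j :: bot).filter (fun y => decide (j < y)) = [] := by
      rw [List.filter_eq_nil_iff]
      intro y hy
      rcases List.mem_cons.1 hy with rfl | hy
      · simp
      · simpa using hbotle y hy
    rw [this, List.append_nil]
    have := List.length_filter_le (fun y => decide (j < y)) mid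
    omega
  · have htake : M.take (m + j - 1) = mid := by
      rw [hM, ← hlen, Nat.add_sub_cancel, List.take_left]
    have hdrop : M.drop (m + j) = bot := by
      rw [hM, ← hlen]; simp [List.drop_append]
    have hfilter : (bot.map (· - 1)).filter (· ≠ 0) = tail := by
      have h1 : (tail.map (· + 1)).map (· - 1) = tail := by simp [Function.comp_def]
      rw [hbot, List.map_append, h1, List.filter_append]
      have h2 : tail.filter (· ≠ 0) = tail := by
        rw [List.filter_eq_self]
        intro y hy
        have := hpos y (by simp [hy])
        simp; omega
      rw [h2]
      simp
    rw [columnToRow, hjm, reverse_sort_eq μ hMsorted hμ, ← hl]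
    simp only [htake, hdrop, hfilter, hMlen, Nat.add_sub_cancel_left]

lemma exists_partition_of_rank_ge {n m : ℕ} (l : n.Partition)
    (h : -(m : ℤ) + 1 ≤ rank l ∧ 1 ≤ jm m l ∧ part l (m + jm m l + 1) = jm m l - 1) :
    ∃ μ : n.Partition, (1 ≤ jm m μ ∧ part μ (m + jm m μ + 1) = jm m μ ∧ rank μ ≤ -(m : ℤ) ∧
      (μ.parts.filter (fun x => jm m μ < x)).card < m + jm m μ) ∧
      columnToRow m μ = l.parts := by
  obtain ⟨hrank, hj, hp⟩ := h
  have hle := jm_le_part m l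
  obtain ⟨L, hL, hl⟩ := exists_sorted_list l
  have hpart := part_eq_getD l hL hl
  generalize jm m l = j at *
  have hlen : m + j ≤ L.length := by
    by_contra! hlt
    rw [hpart, List.getD_eq_default _ _ (by omega)] at hle
    omega
  obtain ⟨x, T, rfl⟩ : ∃ x T, L = x :: T := List.exists_cons_of_length_pos (by omega)
  rw [rank, ← hl, hpart] at hrank
  simp only [Multiset.coe_card, List.length_cons, Nat.sub_self, List.getD_cons_zero] at hrank hlen
  have hsplit := List.take_append_drop (m + j - 1) T
  have hall : ∀ i < m + j, j ≤ (x :: T).getD i 0 := fun i hi => by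
    rw [← Nat.add_sub_cancel (n := i) (m := 1), ← hpart]
    exact hle.trans (part_antitone l (by omega))
  refine exists_partition_of_append (x := x) (mid := T.take (m + j - 1))
    (tail := T.drop (m + j - 1)) l hj ?_ ?_ ?_ ?_ ?_ ?_ ?_
  · rw [List.length_take]; omega
  · rwa [hsplit]
  · rwa [hsplit]
  · exact hall 0 (by omega)
  · intro y hy
    obtain ⟨i, hi, rfl⟩ := List.getElem_of_mem hy
    rw [List.length_take] at hi
    have := hall (i + 1) (by omega)
    rw [List.getD_cons_succ, List.getD_eq_getElem _ _ (by omega)] at this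
    simpa using this
  · rw [← hp, hpart]
    obtain ⟨d, hd⟩ : ∃ d, m + j = d + 1 := ⟨m + j - 1, by omega⟩
    simp [hd]
  · rw [List.length_drop]; omega

end RankCrank

open RankCrank in
/-- For `m ≥ 0` and `n > 1`, the number of partitions `λ` of `n` with
`rank λ ≥ -m+1`, `j = j_m(λ) ≥ 1` and `λ_{m+j+1} = j-1` is at most the number of
partitions `μ` of `n` with `j' = j_m(μ) ≥ 1`, `μ_{m+j'+1} = j'`, `rank μ ≤ -m`,
and fewer than `m + j'` parts of `μ` greater than `j'`. -/
theorem card_P2_le_card_Q2 (m : ℕ) (n : ℕ) (hn : 1 < n) :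
    Nat.card {l : n.Partition //
        -(m : ℤ) + 1 ≤ rank l ∧ 1 ≤ jm m l ∧ part l (m + jm m l + 1) = jm m l - 1}
      ≤ Nat.card {l : n.Partition //
        1 ≤ jm m l ∧ part l (m + jm m l + 1) = jm m l ∧ rank l ≤ -(m : ℤ) ∧
          (l.parts.filter (fun x => jm m l < x)).card < m + jm m l} := by
  choose f hf hparts using fun l : {l : n.Partition // -(m : ℤ) + 1 ≤ rank l ∧ 1 ≤ jm m l ∧
    part l (m + jm m l + 1) = jm m l - 1} => exists_partition_of_rank_ge l.1 l.2
  refine Nat.card_le_card_of_injective (fun l => ⟨f l, hf l⟩) fun a b hab => ?_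
  have hab : f a = f b := congrArg Subtype.val hab
  exact Subtype.ext (Nat.Partition.ext (by rw [← hparts a, ← hparts b, hab]))
end

section
/- Let m ≥ 0 and n > 1. The number of partitions λ of n such that (writing j = j_m(λ)) rank(λ) ≥ −m+1, j ≥ 2 and λ_{m+j+1} ≤ j−2, is at most the number of partitions μ of n such that (writing j' = j_m(μ)) j' ≥ 1, μ_{m+j'+1} = j', rank(μ) ≤ −m, and the number of parts of μ that are greater than j' equals m + j'. -/
open scoped BigOperators

namespace RankCrank

open YoungDiagram

/-! ### Partitions as Young diagrams -/

/-- The parts of a partition in weakly decreasing order. -/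
def partList {n : ℕ} (l : n.Partition) : List ℕ :=
  (l.parts.sort (· ≤ ·)).reverse

theorem coe_partList {n : ℕ} (l : n.Partition) : (partList l : Multiset ℕ) = l.parts := by
  rw [partList, Multiset.coe_reverse, Multiset.sort_eq]

theorem partList_sortedGE {n : ℕ} (l : n.Partition) : (partList l).SortedGE :=
  (Multiset.pairwise_sort l.parts (· ≤ ·)).sortedLE.reverse

theorem pos_of_mem_partList {n : ℕ} (l : n.Partition) (x : ℕ) (hx : x ∈ partList l) : 0 < x := by
  apply l.parts_pos
  rwa [← coe_partList, Multiset.mem_coe]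

/-- The Young diagram of a partition. -/
def diagram {n : ℕ} (l : n.Partition) : YoungDiagram :=
  ofRowLens (partList l) (partList_sortedGE l)

theorem rowLens_diagram {n : ℕ} (l : n.Partition) : (diagram l).rowLens = partList l :=
  rowLens_ofRowLens_eq_self (pos_of_mem_partList l)

theorem coe_rowLens_diagram {n : ℕ} (l : n.Partition) :
    ((diagram l).rowLens : Multiset ℕ) = l.parts := by
  rw [rowLens_diagram, coe_partList]

theorem part_succ {n : ℕ} (l : n.Partition) (i : ℕ) : part l (i + 1) = (diagram l).rowLen i := by
  change (partList l).getD i 0 = _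
  rw [← rowLens_diagram]
  by_cases h : i < (diagram l).rowLens.length
  · rw [List.getD_eq_getElem _ _ h, get_rowLens]
  · rw [List.getD_eq_default _ _ (not_lt.mp h)]
    rw [length_rowLens, ← mem_iff_lt_colLen, mem_iff_lt_rowLen] at h
    omega

theorem card_parts {n : ℕ} (l : n.Partition) : l.parts.card = (diagram l).colLen 0 := by
  rw [← coe_rowLens_diagram, Multiset.coe_card, length_rowLens]

theorem card_filter_parts {n : ℕ} (l : n.Partition) (j : ℕ) :
    (l.parts.filter (fun x => j < x)).card = (diagram l).colLen j := by
  rw [← coe_rowLens_diagram, rowLens, ← Multiset.map_coe, Multiset.filter_map, Multiset.card_map]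
  change (Finset.filter (fun i => j < (diagram l).rowLen i)
    (Finset.range ((diagram l).colLen 0))).card = _
  rw [← Finset.card_range ((diagram l).colLen j)]
  congr 1
  ext i
  rw [Finset.mem_filter, Finset.mem_range, Finset.mem_range, ← mem_iff_lt_rowLen,
    ← mem_iff_lt_colLen, ← mem_iff_lt_colLen]
  exact ⟨fun h => h.2, fun h => ⟨(diagram l).up_left_mem le_rfl (Nat.zero_le _) h, h⟩⟩

theorem sum_rowLens (Y : YoungDiagram) : Y.rowLens.sum = Y.card := by
  rw [rowLens, ← Multiset.sum_coe, ← Multiset.map_coe]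
  change ∑ i ∈ Finset.range (Y.colLen 0), Y.rowLen i = Y.cells.card
  rw [Finset.card_eq_sum_card_fiberwise (f := Prod.fst) (t := Finset.range (Y.colLen 0))]
  · exact Finset.sum_congr rfl fun i _ => Y.rowLen_eq_card
  · rintro ⟨i, j⟩ h
    simpa [← mem_iff_lt_colLen] using Y.up_left_mem le_rfl (Nat.zero_le j) h

theorem card_diagram {n : ℕ} (l : n.Partition) : (diagram l).card = n := by
  rw [← sum_rowLens, ← Multiset.sum_coe, coe_rowLens_diagram, l.parts_sum]

theorem diagram_injective {n : ℕ} : Function.Injective (diagram (n := n)) := by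
  intro l l' h
  ext1
  rw [← coe_rowLens_diagram, h, coe_rowLens_diagram]

theorem exists_diagram_eq {n : ℕ} (Y : YoungDiagram) (hY : Y.card = n) :
    ∃ l : n.Partition, diagram l = Y := by
  refine ⟨⟨Y.rowLens, fun {i} hi => Y.pos_of_mem_rowLens i (Multiset.mem_coe.1 hi), ?_⟩, ?_⟩
  · rw [Multiset.sum_coe, sum_rowLens, hY]
  · refine equivListRowLens.injective (Subtype.ext ?_)
    refine List.Perm.eq_of_sortedGE (rowLens_sorted _) (rowLens_sorted _) ?_
    exact Multiset.coe_eq_coe.1 (coe_rowLens_diagram _)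

/-! ### Durfee rectangles in terms of cells -/

theorem succ_le_part_iff {n : ℕ} (l : n.Partition) (m t : ℕ) :
    t + 1 ≤ part l (m + (t + 1)) ↔ (m + t, t) ∈ diagram l := by
  rw [← add_assoc, part_succ, mem_iff_lt_rowLen, Nat.succ_le_iff]

theorem jm_isGreatest {n : ℕ} (m : ℕ) (l : n.Partition) :
    IsGreatest {j : ℕ | j ≤ part l (m + j)} (jm m l) := by
  have hb : BddAbove {j : ℕ | j ≤ part l (m + j)} := by
    refine ⟨(diagram l).rowLen 0, fun j hj => ?_⟩
    rcases j with _ | t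
    · exact Nat.zero_le _
    · have h := (succ_le_part_iff l m t).1 hj
      exact mem_iff_lt_rowLen.1 ((diagram l).up_left_mem (Nat.zero_le _) le_rfl h)
  exact ⟨Nat.sSup_mem ⟨0, Nat.zero_le _⟩ hb, fun j hj => le_csSup hb hj⟩

theorem jm_eq_succ_iff {n : ℕ} (m t : ℕ) (l : n.Partition) :
    jm m l = t + 1 ↔ (m + t, t) ∈ diagram l ∧ (m + (t + 1), t + 1) ∉ diagram l := by
  have hg := jm_isGreatest m l
  rw [← succ_le_part_iff, ← succ_le_part_iff]
  constructor
  · intro h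
    rw [h] at hg
    exact ⟨hg.1, fun h' => absurd (hg.2 h') (by omega)⟩
  · rintro ⟨h1, h2⟩
    refine le_antisymm ?_ (hg.2 h1)
    by_contra! h3
    obtain ⟨s, hs⟩ : ∃ s, jm m l = s + 1 := ⟨jm m l - 1, by omega⟩
    have h4 : s + 1 ≤ part l (m + (s + 1)) := hs ▸ hg.1
    rw [succ_le_part_iff] at h2 h4
    exact h2 ((diagram l).up_left_mem (by omega) (by omega) h4)

/-! ### Exchanging tails of two sequences -/

/-- The first sequence produced by the tail exchange of `x` and `y` at position `i`. -/
def fstSeq (i : ℕ) (x y : ℕ → ℕ) (k : ℕ) : ℕ := if k < i then x k - 1 else y (k + 1)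

/-- The second sequence produced by the tail exchange of `x` and `y` at position `i`. -/
def sndSeq (i : ℕ) (x y : ℕ → ℕ) (k : ℕ) : ℕ := if k ≤ i then y k + 1 else x (k - 1)

/-- `i` is the first index at which `x` exceeds `y` by at most one. -/
def IsCrossing (i : ℕ) (x y : ℕ → ℕ) : Prop :=
  x i ≤ y i + 1 ∧ ∀ k < i, y k + 1 < x k

theorem fstSeq_antitone {i : ℕ} {x y : ℕ → ℕ} (hx : Antitone x) (hy : Antitone y)
    (hi : IsCrossing i x y) : Antitone (fstSeq i x y) := by
  refine antitone_nat_of_succ_le fun k => ?_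
  have h1 := hx (Nat.le_succ k)
  have h2 := hy (Nat.le_succ (k + 1))
  have h3 := hy (show k ≤ k + 1 + 1 by omega)
  have h4 := hi.2 k
  simp only [Nat.succ_eq_add_one] at *
  unfold fstSeq
  split_ifs <;> omega

theorem sndSeq_antitone {i : ℕ} {x y : ℕ → ℕ} (hx : Antitone x) (hy : Antitone y)
    (hi : IsCrossing i x y) : Antitone (sndSeq i x y) := by
  refine antitone_nat_of_succ_le fun k => ?_
  have h1 := hy (Nat.le_succ k)
  have h2 := hx (show k - 1 ≤ k + 1 - 1 by omega)
  have h4 := hi.1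
  simp only [Nat.succ_eq_add_one] at *
  unfold sndSeq
  split_ifs with h5 h6 h6
  · omega
  · omega
  · obtain rfl : k = i := by omega
    simpa using h4
  · exact h2

theorem sum_fstSeq_add_sndSeq_of_le (i : ℕ) (x y : ℕ → ℕ) (hi : IsCrossing i x y) (K : ℕ)
    (hK : K ≤ i) :
    ∑ k ∈ Finset.range K, (fstSeq i x y k + sndSeq i x y k) =
      ∑ k ∈ Finset.range K, x k + ∑ k ∈ Finset.range K, y k := by
  rw [← Finset.sum_add_distrib]
  refine Finset.sum_congr rfl fun k hk => ?_
  have hk' := Finset.mem_range.1 hk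
  have := hi.2 k (by omega)
  rw [fstSeq, sndSeq, if_pos (by omega), if_pos (by omega)]
  omega

theorem sum_fstSeq_add_sndSeq (i : ℕ) (x y : ℕ → ℕ) (hi : IsCrossing i x y) (L : ℕ) (hL : i ≤ L) :
    ∑ k ∈ Finset.range (L + 1), (fstSeq i x y k + sndSeq i x y k) =
      ∑ k ∈ Finset.range L, x k + ∑ k ∈ Finset.range (L + 2), y k + 1 := by
  induction L, hL using Nat.le_induction with
  | base =>
    rw [Finset.sum_range_succ, sum_fstSeq_add_sndSeq_of_le i x y hi i le_rfl,
      Finset.sum_range_succ _ (i + 1), Finset.sum_range_succ _ i, fstSeq, sndSeq,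
      if_neg (by omega), if_pos le_rfl]
    omega
  | succ L hL ih =>
    rw [Finset.sum_range_succ, ih, Finset.sum_range_succ _ (L + 2), Finset.sum_range_succ x L,
      fstSeq, sndSeq, if_neg (by omega), if_neg (by omega), Nat.add_sub_cancel,
      add_assoc L 1 1]
    omega

theorem exchange_injective {i i' : ℕ} {x y x' y' : ℕ → ℕ} (hy : Antitone y)
    (hy' : Antitone y') (hi : IsCrossing i x y) (hi' : IsCrossing i' x' y')
    (h1 : fstSeq i x y = fstSeq i' x' y') (h2 : sndSeq i x y = sndSeq i' x' y') :
    x = x' ∧ y = y' := by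
  have key : ∀ {i : ℕ} {x y : ℕ → ℕ}, Antitone y → IsCrossing i x y →
      fstSeq i x y i < sndSeq i x y i ∧ ∀ k < i, sndSeq i x y k ≤ fstSeq i x y k := by
    intro i x y hy hi
    refine ⟨?_, fun k hk => ?_⟩
    · have := hy (Nat.le_succ i)
      rw [fstSeq, sndSeq, if_neg (by omega), if_pos le_rfl]
      exact Nat.lt_succ_of_le this
    · have := hi.2 k hk
      rw [fstSeq, sndSeq, if_pos hk, if_pos hk.le]
      omega
  have k1 := key hy hi
  have k2 := key hy' hi'
  rw [← h1, ← h2] at k2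
  obtain rfl : i = i' := by
    rcases lt_trichotomy i i' with h | h | h
    · exact absurd (k2.2 i h) (by omega)
    · exact h
    · exact absurd (k1.2 i' h) (by omega)
  constructor
  · funext k
    by_cases hk : k < i
    · have e := congrFun h1 k
      have := hi.2 k hk
      have := hi'.2 k hk
      rw [fstSeq, fstSeq, if_pos hk, if_pos hk] at e
      omega
    · have e := congrFun h2 (k + 1)
      rwa [sndSeq, sndSeq, if_neg (by omega), if_neg (by omega), Nat.add_sub_cancel] at e
  · funext k
    by_cases hk : k ≤ i
    · have e := congrFun h2 k
      rw [sndSeq, sndSeq, if_pos hk, if_pos hk] at e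
      omega
    · obtain ⟨s, rfl⟩ : ∃ s, k = s + 1 := ⟨k - 1, by omega⟩
      have e := congrFun h1 s
      rwa [fstSeq, fstSeq, if_neg (by omega), if_neg (by omega)] at e

/-! ### Exchanging tails in a Young diagram -/

/-- The Young diagram made of an `(a + 1) × (b + 1)` rectangle without its corner, columns `c` to
the right of it and rows `d` below it. -/
theorem exists_youngDiagram (a b K : ℕ) (c d : ℕ → ℕ) (hc : Antitone c) (hd : Antitone d)
    (hc0 : c 0 ≤ a) (hd0 : d 0 ≤ b) (hcK : c K = 0) (hdK : d K = 0) :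
    ∃ Z : YoungDiagram, (∀ r ≤ a, ∀ s ≤ b, (r, s) ∈ Z ↔ ¬ (r = a ∧ s = b)) ∧
      (∀ k, Z.colLen (b + 1 + k) = c k) ∧ ∀ k, Z.rowLen (a + 1 + k) = d k := by
  classical
  let P : ℕ × ℕ → Prop := fun p =>
    (p.1 ≤ a ∧ p.2 ≤ b ∧ ¬ (p.1 = a ∧ p.2 = b)) ∨ (b < p.2 ∧ p.1 < c (p.2 - (b + 1))) ∨
      (a < p.1 ∧ p.2 < d (p.1 - (a + 1)))
  have hca : ∀ k, c k ≤ a := fun k => (hc (Nat.zero_le k)).trans hc0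
  have hdb : ∀ k, d k ≤ b := fun k => (hd (Nat.zero_le k)).trans hd0
  have hmem : ∀ p, p ∈ (Finset.range (a + 1 + K) ×ˢ Finset.range (b + 1 + K)).filter P ↔ P p := by
    rintro ⟨r, s⟩
    rw [Finset.mem_filter, and_iff_right_iff_imp, Finset.mem_product, Finset.mem_range,
      Finset.mem_range]
    have h1 := hca (s - (b + 1))
    have h2 := hdb (r - (a + 1))
    have h3 := @hc K (s - (b + 1))
    have h4 := @hd K (r - (a + 1))
    simp only [P]
    omega
  let Z : YoungDiagram := ⟨(Finset.range (a + 1 + K) ×ˢ Finset.range (b + 1 + K)).filter P, by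
    rintro ⟨r, s⟩ ⟨r', s'⟩ ⟨hr : r' ≤ r, hs : s' ≤ s⟩ h
    rw [Finset.mem_coe, hmem] at h ⊢
    have h1 := hca (s - (b + 1))
    have h2 := hdb (r - (a + 1))
    have h3 := @hc (s' - (b + 1)) (s - (b + 1)) (by omega)
    have h4 := @hd (r' - (a + 1)) (r - (a + 1)) (by omega)
    simp only [P] at h ⊢
    omega⟩
  have hZ : ∀ r s, (r, s) ∈ Z ↔ P (r, s) := fun r s => hmem (r, s)
  refine ⟨Z, fun r hr s hs => ?_, fun k => ?_, fun k => ?_⟩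
  · rw [hZ]
    simp only [P]
    omega
  · refine eq_of_forall_lt_iff fun r => ?_
    have := hca k
    have := hdb (r - (a + 1))
    rw [← mem_iff_lt_colLen, hZ]
    simp only [P, Nat.add_sub_cancel_left]
    omega
  · refine eq_of_forall_lt_iff fun s => ?_
    have := hdb k
    have := hca (s - (b + 1))
    rw [← mem_iff_lt_rowLen, hZ]
    simp only [P, Nat.add_sub_cancel_left]
    omega

theorem card_eq_sum (Y : YoungDiagram) (a b K : ℕ) (hab : (a, b) ∉ Y) (hr : Y.rowLen (a + K) = 0)
    (hc : Y.colLen (b + K) = 0) :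
    Y.card = (Y.cells.filter (fun p => p.1 < a ∧ p.2 < b)).card +
      (∑ k ∈ Finset.range K, Y.colLen (b + k) + ∑ k ∈ Finset.range K, Y.rowLen (a + k)) := by
  have hdisj : ∀ r s, (r, s) ∈ Y → r < a ∨ s < b := by
    intro r s h
    by_contra! h'
    exact hab (Y.up_left_mem h'.1 h'.2 h)
  have hright : (Y.cells.filter (fun p => b ≤ p.2)).card =
      ∑ k ∈ Finset.range K, Y.colLen (b + k) := by
    rw [Finset.card_eq_sum_card_fiberwise (f := fun p => p.2 - b) (t := Finset.range K)]
    · refine Finset.sum_congr rfl fun k _ => ?_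
      rw [colLen_eq_card]
      congr 1
      ext ⟨r, s⟩
      simp only [Finset.mem_filter, mem_col_iff, mem_cells]
      constructor
      · rintro ⟨⟨h1, h2⟩, h3⟩
        exact ⟨h1, by omega⟩
      · rintro ⟨h1, h2⟩
        exact ⟨⟨h1, by omega⟩, by omega⟩
    · rintro ⟨r, s⟩ h
      simp only [Finset.coe_filter, Set.mem_ofPred_eq, mem_cells, Finset.coe_range,
        Set.mem_Iio] at h ⊢
      by_contra! h'
      have := mem_iff_lt_colLen.1 (Y.up_left_mem le_rfl (show b + K ≤ s by omega) h.1)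
      omega
  have hbelow : (Y.cells.filter (fun p => a ≤ p.1)).card =
      ∑ k ∈ Finset.range K, Y.rowLen (a + k) := by
    rw [Finset.card_eq_sum_card_fiberwise (f := fun p => p.1 - a) (t := Finset.range K)]
    · refine Finset.sum_congr rfl fun k _ => ?_
      rw [rowLen_eq_card]
      congr 1
      ext ⟨r, s⟩
      simp only [Finset.mem_filter, mem_row_iff, mem_cells]
      constructor
      · rintro ⟨⟨h1, h2⟩, h3⟩
        exact ⟨h1, by omega⟩
      · rintro ⟨h1, h2⟩
        exact ⟨⟨h1, by omega⟩, by omega⟩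
    · rintro ⟨r, s⟩ h
      simp only [Finset.coe_filter, Set.mem_ofPred_eq, mem_cells, Finset.coe_range,
        Set.mem_Iio] at h ⊢
      by_contra! h'
      have := mem_iff_lt_rowLen.1 (Y.up_left_mem (show a + K ≤ r by omega) le_rfl h.1)
      omega
  rw [← hright, ← hbelow, ← Finset.card_union_of_disjoint, ← Finset.card_union_of_disjoint]
  · change Y.cells.card = _
    congr 1
    ext ⟨r, s⟩
    simp only [Finset.mem_union, Finset.mem_filter, mem_cells]
    constructor
    · intro h
      by_cases h1 : b ≤ s
      · exact Or.inr (Or.inl ⟨h, h1⟩)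
      · by_cases h2 : a ≤ r
        · exact Or.inr (Or.inr ⟨h, h2⟩)
        · exact Or.inl ⟨h, by omega, by omega⟩
    · tauto
  · rw [Finset.disjoint_left]
    rintro ⟨r, s⟩ h1 h2
    simp only [Finset.mem_union, Finset.mem_filter] at h1 h2
    omega
  · rw [Finset.disjoint_left]
    rintro ⟨r, s⟩ h1 h2
    simp only [Finset.mem_filter, mem_cells] at h1 h2
    have := hdisj r s h1.1
    omega

/-- `Z` arises from `Y`, which contains the `(a + 1) × (b + 1)` rectangle, by removing the corner of
the rectangle and exchanging tails between the columns to its right and the rows below it. -/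
def IsExchange (a b : ℕ) (Y Z : YoungDiagram) : Prop :=
  ∃ i, IsCrossing i (fun k => Y.colLen (b + 1 + k)) (fun k => Y.rowLen (a + 1 + k)) ∧
    (∀ r ≤ a, ∀ s ≤ b, (r, s) ∈ Z ↔ ¬ (r = a ∧ s = b)) ∧
    (∀ k, Z.colLen (b + 1 + k) =
      fstSeq i (fun k => Y.colLen (b + 1 + k)) (fun k => Y.rowLen (a + 1 + k)) k) ∧
    ∀ k, Z.rowLen (a + 1 + k) =
      sndSeq i (fun k => Y.colLen (b + 1 + k)) (fun k => Y.rowLen (a + 1 + k)) k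

theorem antitone_colLen_add (Y : YoungDiagram) (b : ℕ) : Antitone fun k => Y.colLen (b + k) :=
  fun _ _ h => Y.colLen_anti _ _ (Nat.add_le_add_left h b)

theorem antitone_rowLen_add (Y : YoungDiagram) (a : ℕ) : Antitone fun k => Y.rowLen (a + k) :=
  fun _ _ h => Y.rowLen_anti _ _ (Nat.add_le_add_left h a)

theorem IsExchange.injective {a b : ℕ} {Y Y' Z : YoungDiagram} (hab : (a, b) ∈ Y)
    (hab' : (a, b) ∈ Y') (h : IsExchange a b Y Z) (h' : IsExchange a b Y' Z) : Y = Y' := by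
  obtain ⟨i, hi, -, hc, hd⟩ := h
  obtain ⟨i', hi', -, hc', hd'⟩ := h'
  obtain ⟨hx, hy⟩ := exchange_injective (antitone_rowLen_add Y _) (antitone_rowLen_add Y' _) hi hi'
    (funext fun k => (hc k).symm.trans (hc' k)) (funext fun k => (hd k).symm.trans (hd' k))
  ext ⟨r, s⟩
  rw [mem_cells, mem_cells]
  by_cases hs : b + 1 ≤ s
  · obtain ⟨k, rfl⟩ := Nat.exists_eq_add_of_le hs
    have : Y.colLen (b + 1 + k) = Y'.colLen (b + 1 + k) := congrFun hx k
    rw [mem_iff_lt_colLen, mem_iff_lt_colLen, this]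
  · by_cases hr : a + 1 ≤ r
    · obtain ⟨k, rfl⟩ := Nat.exists_eq_add_of_le hr
      have : Y.rowLen (a + 1 + k) = Y'.rowLen (a + 1 + k) := congrFun hy k
      rw [mem_iff_lt_rowLen, mem_iff_lt_rowLen, this]
    · exact iff_of_true (Y.up_left_mem (by omega) (by omega) hab)
        (Y'.up_left_mem (by omega) (by omega) hab')

theorem exists_rowLen_colLen_eq_zero (Y : YoungDiagram) :
    ∃ K, (∀ r, K ≤ r → Y.rowLen r = 0) ∧ ∀ s, K ≤ s → Y.colLen s = 0 := by
  refine ⟨Y.colLen 0 + Y.rowLen 0, fun r hr => ?_, fun s hs => ?_⟩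
  · by_contra h
    have := mem_iff_lt_colLen.1 (mem_iff_lt_rowLen.2 (Nat.pos_of_ne_zero h))
    omega
  · by_contra h
    have := mem_iff_lt_rowLen.1 (mem_iff_lt_colLen.2 (Nat.pos_of_ne_zero h))
    omega

theorem exists_isExchange {a b : ℕ} (hba : b ≤ a) {Y : YoungDiagram} (hab : (a, b) ∈ Y)
    (hb : Y.rowLen (a + 1) < b) :
    ∃ Z : YoungDiagram, IsExchange a b Y Z ∧ Z.card = Y.card := by
  set x : ℕ → ℕ := fun k => Y.colLen (b + 1 + k)
  set y : ℕ → ℕ := fun k => Y.rowLen (a + 1 + k)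
  have hxa : Antitone x := antitone_colLen_add Y _
  have hya : Antitone y := antitone_rowLen_add Y _
  obtain ⟨K, hKr, hKc⟩ := exists_rowLen_colLen_eq_zero Y
  have hxK : ∀ k, K ≤ k → x k = 0 := fun k hk => hKc _ (by omega)
  have hyK : ∀ k, K ≤ k → y k = 0 := fun k hk => hKr _ (by omega)
  have hex : ∃ i, x i ≤ y i + 1 := ⟨K, by rw [hxK K le_rfl]; omega⟩
  obtain ⟨i, hi⟩ : ∃ i, IsCrossing i x y :=
    ⟨Nat.find hex, Nat.find_spec hex, fun k hk => by have := Nat.find_min hex hk; omega⟩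
  have hiK : i ≤ K := by
    by_contra! h
    have := hi.2 K h
    rw [hxK K le_rfl] at this
    omega
  have hx0 : x 0 ≤ a + 1 := by
    by_contra! h
    have := mem_iff_lt_rowLen.1 (mem_iff_lt_colLen.2 h)
    omega
  have hy0 : y 0 < b := hb
  have hc0 : fstSeq i x y 0 ≤ a := by
    have := hya (Nat.zero_le (0 + 1))
    unfold fstSeq
    split_ifs <;> omega
  have hd0 : sndSeq i x y 0 ≤ b := by
    rw [sndSeq, if_pos (Nat.zero_le i)]
    omega
  have hcK : fstSeq i x y (K + 1) = 0 := by
    rw [fstSeq, if_neg (by omega), hyK _ (by omega)]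
  have hdK : sndSeq i x y (K + 1) = 0 := by
    rw [sndSeq, if_neg (by omega), hxK _ (by omega)]
  obtain ⟨Z, hZ, hZc, hZr⟩ := exists_youngDiagram a b (K + 1) _ _
    (fstSeq_antitone hxa hya hi) (sndSeq_antitone hxa hya hi) hc0 hd0 hcK hdK
  refine ⟨Z, ⟨i, hi, hZ, hZc, hZr⟩, ?_⟩
  have hYab : (a + 1, b + 1) ∉ Y := by
    rw [mem_iff_lt_rowLen]
    omega
  have hZab : (a + 1, b + 1) ∉ Z := by
    rw [mem_iff_lt_rowLen]
    have := hZr 0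
    rw [add_zero] at this
    omega
  have hYrect : Y.cells.filter (fun p => p.1 < a + 1 ∧ p.2 < b + 1) =
      Finset.range (a + 1) ×ˢ Finset.range (b + 1) := by
    ext ⟨r, s⟩
    simp only [Finset.mem_filter, mem_cells, Finset.mem_product, Finset.mem_range,
      and_iff_right_iff_imp]
    rintro ⟨h1, h2⟩
    exact Y.up_left_mem (by omega) (by omega) hab
  have hZrect : Z.cells.filter (fun p => p.1 < a + 1 ∧ p.2 < b + 1) =
      (Finset.range (a + 1) ×ˢ Finset.range (b + 1)).erase (a, b) := by
    ext ⟨r, s⟩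
    simp only [Finset.mem_filter, mem_cells, Finset.mem_product, Finset.mem_range,
      Finset.mem_erase, ne_eq, Prod.mk.injEq]
    refine and_congr_left fun h => hZ r (by omega) s (by omega)
  rw [card_eq_sum Z (a + 1) (b + 1) (K + 1) hZab ((hZr _).trans hdK) ((hZc _).trans hcK),
    card_eq_sum Y (a + 1) (b + 1) (K + 2) hYab (hKr _ (by omega)) (hKc _ (by omega)),
    hYrect, hZrect, Finset.card_erase_of_mem (by simp), Finset.sum_congr rfl fun k _ => hZc k,
    Finset.sum_congr rfl fun k _ => hZr k, ← Finset.sum_add_distrib,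
    sum_fstSeq_add_sndSeq i x y hi K hiK]
  change _ = _ + (∑ k ∈ Finset.range (K + 2), x k + ∑ k ∈ Finset.range (K + 2), y k)
  rw [Finset.sum_range_succ x, Finset.sum_range_succ x, hxK K le_rfl, hxK (K + 1) (by omega)]
  have hpos : 0 < (Finset.range (a + 1) ×ˢ Finset.range (b + 1)).card :=
    Finset.card_pos.2 ⟨(0, 0), by simp⟩
  omega

theorem IsExchange.rank_le {m b : ℕ} (hb0 : 0 < b) {Y Z : YoungDiagram}
    (h : IsExchange (m + b) b Y Z) (hrank : Y.colLen 0 < Y.rowLen 0 + m) :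
    Z.rowLen 0 + m ≤ Z.colLen 0 := by
  obtain ⟨i, hi, hZ, hZc, hZr⟩ := h
  by_contra! hlt
  have h1 : m + b < Z.colLen 0 :=
    mem_iff_lt_colLen.1 ((hZ _ le_rfl 0 (Nat.zero_le _)).2 (by omega))
  obtain ⟨k, hk⟩ := Nat.exists_eq_add_of_le (show m + b + 1 ≤ Z.colLen 0 from h1)
  have hd : Z.rowLen (m + b + 1 + k) = 0 := by
    by_contra h
    have := mem_iff_lt_colLen.1 (mem_iff_lt_rowLen.2 (Nat.pos_of_ne_zero h))
    omega
  have hc : 0 < Z.colLen (b + 1 + k) := by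
    rw [← mem_iff_lt_colLen, mem_iff_lt_rowLen]
    omega
  rw [hZr, sndSeq] at hd
  split_ifs at hd with hki
  rw [hZc, fstSeq, if_neg (by omega), ← mem_iff_lt_rowLen, mem_iff_lt_colLen] at hc
  have hx : ¬ (0, b + 1 + (k - 1)) ∈ Y := by
    rw [mem_iff_lt_colLen]
    omega
  rw [mem_iff_lt_rowLen] at hx
  omega

theorem exists_exchange_partition {n m b : ℕ} (l : n.Partition) (hj : jm m l = b + 1)
    (hrank : -(m : ℤ) + 1 ≤ rank l) (h2 : 2 ≤ jm m l)
    (hpart : part l (m + jm m l + 1) ≤ jm m l - 2) :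
    ∃ l' : n.Partition, IsExchange (m + b) b (diagram l) (diagram l') ∧ jm m l' = b ∧
      part l' (m + b + 1) = b ∧ rank l' ≤ -(m : ℤ) ∧
      (l'.parts.filter (fun x => b < x)).card = m + b := by
  rw [hj, part_succ] at hpart
  rw [hj] at h2
  have hab := ((jm_eq_succ_iff m b l).1 hj).1
  have hlen : (diagram l).rowLen (m + b + 1) < b := by
    rw [← add_assoc] at hpart
    omega
  obtain ⟨Z, hZ, hcard⟩ := exists_isExchange (Nat.le_add_left b m) hab hlen
  rw [card_diagram] at hcard
  obtain ⟨l', rfl⟩ := exists_diagram_eq Z hcard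
  have hcells := hZ.choose_spec.2.1
  refine ⟨l', hZ, ?_, ?_, ?_, ?_⟩
  · obtain ⟨t, rfl⟩ : ∃ t, b = t + 1 := ⟨b - 1, by omega⟩
    rw [jm_eq_succ_iff, hcells _ (by omega) _ (by omega), hcells _ (by omega) _ (by omega)]
    omega
  · rw [part_succ]
    refine eq_of_forall_lt_iff fun s => ?_
    rw [← mem_iff_lt_rowLen]
    constructor
    · intro h
      by_contra! h'
      exact (hcells _ le_rfl _ le_rfl).1 ((diagram l').up_left_mem le_rfl h' h) ⟨rfl, rfl⟩
    · intro h
      exact (hcells _ le_rfl _ h.le).2 (by omega)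
  · rw [rank, card_parts, part_succ l 0] at hrank
    rw [rank, card_parts, part_succ l' 0]
    have := hZ.rank_le (by omega) (by omega)
    omega
  · rw [card_filter_parts]
    refine eq_of_forall_lt_iff fun r => ?_
    rw [← mem_iff_lt_colLen]
    constructor
    · intro h
      by_contra! h'
      exact (hcells _ le_rfl _ le_rfl).1 ((diagram l').up_left_mem h' le_rfl h) ⟨rfl, rfl⟩
    · intro h
      exact (hcells _ h.le _ le_rfl).2 (by omega)

end RankCrank

open RankCrank in
/-- For `m ≥ 0` and `n > 1`, the number of partitions `λ` of `n` with
`rank λ ≥ -m+1`, `j = j_m(λ) ≥ 2` and `λ_{m+j+1} ≤ j-2` is at most the number of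
partitions `μ` of `n` with `j' = j_m(μ) ≥ 1`, `μ_{m+j'+1} = j'`, `rank μ ≤ -m`,
and exactly `m + j'` parts of `μ` greater than `j'`. -/
theorem card_P3_le_card_Q3 (m : ℕ) (n : ℕ) (hn : 1 < n) :
    Nat.card {l : n.Partition //
        -(m : ℤ) + 1 ≤ rank l ∧ 2 ≤ jm m l ∧ part l (m + jm m l + 1) ≤ jm m l - 2}
      ≤ Nat.card {l : n.Partition //
        1 ≤ jm m l ∧ part l (m + jm m l + 1) = jm m l ∧ rank l ≤ -(m : ℤ) ∧
          (l.parts.filter (fun x => jm m l < x)).card = m + jm m l} := by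
  have hpred : ∀ l : n.Partition, 2 ≤ jm m l → jm m l = jm m l - 1 + 1 := fun l h => by omega
  choose f hf using fun l : {l : n.Partition //
      -(m : ℤ) + 1 ≤ rank l ∧ 2 ≤ jm m l ∧ part l (m + jm m l + 1) ≤ jm m l - 2} =>
    exists_exchange_partition l.1 (hpred l.1 l.2.2.1) l.2.1 l.2.2.1 l.2.2.2
  refine Nat.card_le_card_of_injective (fun l => ⟨f l, ?_⟩) ?_
  · obtain ⟨-, h1, h2, h3, h4⟩ := hf l
    have := l.2.2.1
    rw [h1]
    exact ⟨by omega, h2, h3, h4⟩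
  · intro l l' h
    have hfl : f l = f l' := congrArg Subtype.val h
    obtain ⟨e, hj, -⟩ := hf l
    obtain ⟨e', hj', -⟩ := hf l'
    rw [hfl] at e hj
    rw [hj] at hj'
    rw [← hj'] at e'
    have hab := ((jm_eq_succ_iff m _ l.1).1 (hpred l.1 l.2.2.1)).1
    have hab' := ((jm_eq_succ_iff m _ l'.1).1 (hpred l'.1 l'.2.2.1)).1
    rw [← hj'] at hab'
    exact Subtype.ext (diagram_injective (e.injective hab hab' e'))
end

section
/- For every negative integer m and every integer n ≥ 1, M(≤ m, n) = p(n) − q(−m−1, n). -/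
open scoped BigOperators

namespace RankCrank

/-- The number of elements of `s` exceeding `t`. -/
def numGT (s : Multiset ℕ) (t : ℕ) : ℕ := s.countP (t < ·)

lemma numGT_eq_count_add (s : Multiset ℕ) (t : ℕ) :
    numGT s t = s.count (t + 1) + numGT s (t + 1) := by
  unfold numGT
  induction s using Multiset.induction_on with
  | empty => simp
  | cons a s ih =>
    simp only [Multiset.countP_cons, Multiset.count_cons, ih]
    grind

lemma numGT_antitone (s : Multiset ℕ) : Antitone (numGT s) :=
  antitone_nat_of_succ_le fun t => by rw [numGT_eq_count_add s t]; omega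

lemma numGT_eq_zero {n : ℕ} (l : n.Partition) {t : ℕ} (ht : n ≤ t) : numGT l.parts t = 0 := by
  refine Multiset.countP_eq_zero.2 fun a ha => ?_
  have := l.le_of_mem_parts ha
  omega

lemma numGT_le {n : ℕ} (l : n.Partition) (t : ℕ) : numGT l.parts t ≤ n := by
  have h : l.parts.card • 1 ≤ l.parts.sum :=
    Multiset.card_nsmul_le_sum fun x hx => l.parts_pos hx
  rw [l.parts_sum, smul_eq_mul, mul_one] at h
  exact (Multiset.countP_le_card _ _).trans h

lemma partition_ext_numGT {n : ℕ} {l l' : n.Partition}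
    (h : ∀ t, numGT l.parts t = numGT l'.parts t) : l = l' := by
  ext x
  cases x with
  | zero =>
    rw [Multiset.count_eq_zero_of_notMem fun h0 => (l.parts_pos h0).false,
      Multiset.count_eq_zero_of_notMem fun h0 => (l'.parts_pos h0).false]
  | succ t =>
    have h1 := numGT_eq_count_add l.parts t
    have h2 := numGT_eq_count_add l'.parts t
    have h3 := h t
    have h4 := h (t + 1)
    omega

lemma lt_getD_iff_lt_countP {L : List ℕ} (hL : L.Pairwise (· ≥ ·)) (t j : ℕ) :
    t < L.getD j 0 ↔ j < L.countP (t < ·) := by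
  induction L generalizing j with
  | nil => simp
  | cons a L ih =>
    rw [List.pairwise_cons] at hL
    by_cases hat : t < a
    · cases j with
      | zero => simp [hat]
      | succ j => simpa [List.countP_cons, hat] using ih hL.2 j
    · have h0 : L.countP (t < ·) = 0 := by
        rw [List.countP_eq_zero]
        intro b hb
        have := hL.1 b hb
        simp; omega
      cases j with
      | zero => simp [hat, h0]
      | succ j =>
        have := ih hL.2 j
        simp only [List.getD_cons_succ, this, h0, List.countP_cons]
        simp [hat]

lemma lt_part_iff {n : ℕ} (l : n.Partition) (t j : ℕ) :
    t < part l (j + 1) ↔ j < numGT l.parts t := by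
  have hs : ((l.parts.sort (· ≤ ·)).reverse).Pairwise (· ≥ ·) := by
    rw [List.pairwise_reverse]
    exact l.parts.pairwise_sort (· ≤ ·)
  rw [part, Nat.add_sub_cancel, lt_getD_iff_lt_countP hs, numGT, List.countP_reverse,
    ← Multiset.coe_countP, Multiset.sort_eq]

lemma part_le {n : ℕ} (l : n.Partition) (j : ℕ) : part l (j + 1) ≤ n := by
  by_contra! h
  rw [lt_part_iff, numGT_eq_zero l le_rfl] at h
  omega

lemma card_filter_range_lt {n a : ℕ} (h : a ≤ n) : ((Finset.range n).filter (· < a)).card = a := by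
  have : (Finset.range n).filter (· < a) = Finset.range a := by ext; simp; omega
  rw [this, Finset.card_range]

lemma sum_range_numGT {n : ℕ} (s : Multiset ℕ) (hs : ∀ x ∈ s, x ≤ n) :
    ∑ t ∈ Finset.range n, numGT s t = s.sum := by
  induction s using Multiset.induction_on with
  | empty => simp [numGT]
  | cons a s ih =>
    have h1 := ih fun x hx => hs x (Multiset.mem_cons_of_mem hx)
    have h2 := card_filter_range_lt (hs a (Multiset.mem_cons_self a s))
    rw [Finset.card_filter] at h2
    simp only [numGT, Multiset.countP_cons, Finset.sum_add_distrib, Multiset.sum_cons] at h1 h2 ⊢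
    omega

lemma sum_map_range_numGT {n : ℕ} (l : n.Partition) :
    ((Multiset.range n).map (numGT l.parts)).sum = n :=
  (sum_range_numGT l.parts fun _ hx => l.le_of_mem_parts hx).trans l.parts_sum

/-- The conjugate partition, whose parts are the positive numbers among the `numGT l.parts t`. -/
def conj {n : ℕ} (l : n.Partition) : n.Partition :=
  Nat.Partition.ofSums n ((Multiset.range n).map (numGT l.parts))
    (sum_map_range_numGT l)

lemma numGT_conj {n : ℕ} (l : n.Partition) (j : ℕ) :
    numGT (conj l).parts j = part l (j + 1) := by
  have h : numGT (conj l).parts j =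
      ((Finset.range n).filter (fun t => t < part l (j + 1))).card := by
    simp only [lt_part_iff]
    rw [numGT, conj, Nat.Partition.ofSums_parts, Multiset.countP_filter, Multiset.countP_map,
      Finset.card_def, Finset.filter_val, Finset.range_val]
    congr 1
    refine Multiset.filter_congr fun x _ => ?_
    omega
  rw [h, card_filter_range_lt (part_le l j)]

lemma conj_conj {n : ℕ} (l : n.Partition) : conj (conj l) = l := by
  refine partition_ext_numGT fun t => ?_
  rw [numGT_conj]
  refine eq_of_forall_lt_iff fun c => ?_
  rw [lt_part_iff, numGT_conj, lt_part_iff]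

lemma mem_rankSet_conj_iff {n : ℕ} (l : n.Partition) (k : ℕ) :
    (k : ℤ) ∈ rankSet (conj l) ↔ ∃ j, numGT l.parts j + k = j := by
  have h (j : ℕ) : part (conj l) (j + 1) = numGT l.parts j := by
    rw [← numGT_conj, conj_conj]
  simp only [rankSet, Set.mem_ofPred_eq, h]
  exact exists_congr fun j => by omega

open Classical in
lemma q_add_card (k n : ℕ) :
    q k n + (Finset.univ.filter fun l : n.Partition => ∀ j, numGT l.parts j + k ≠ j).card
      = p n := by
  have hq : q k n =
      (Finset.univ.filter fun l : n.Partition => ∃ j, numGT l.parts j + k = j).card := by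
    rw [q, Nat.card_eq_fintype_card, Fintype.card_subtype]
    refine Finset.card_bij' (fun l _ => conj l) (fun l _ => conj l) ?_ ?_ ?_ ?_
    · intro l hl
      simp only [Finset.mem_filter, Finset.mem_univ, true_and] at hl ⊢
      rwa [← mem_rankSet_conj_iff, conj_conj]
    · intro l hl
      simp only [Finset.mem_filter, Finset.mem_univ, true_and] at hl ⊢
      rwa [mem_rankSet_conj_iff]
    · exact fun l _ => conj_conj l
    · exact fun l _ => conj_conj l
  have := Finset.card_filter_add_card_filter_not (s := (Finset.univ : Finset n.Partition))
    (fun l : n.Partition => ∃ j, numGT l.parts j + k = j)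
  rw [hq, p, Nat.card_eq_fintype_card, ← Finset.card_univ, ← this]
  simp only [not_exists, ne_eq]

/-- Adjoining the parts in `r` identifies partitions of `n - r.sum` with the partitions of `n`
whose parts include `r`. -/
lemma card_filter_le_parts {n : ℕ} (r : Multiset ℕ) (hr : ∀ x ∈ r, 0 < x) (hn : r.sum ≤ n)
    (P Q : Multiset ℕ → Prop) [DecidablePred P] [DecidablePred Q]
    (hPQ : ∀ s, Q (r + s) ↔ P s) :
    (Finset.univ.filter fun l : n.Partition => r ≤ l.parts ∧ Q l.parts).card =
      (Finset.univ.filter fun l : (n - r.sum).Partition => P l.parts).card := by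
  symm
  refine Finset.card_bij
    (fun l _ => ⟨r + l.parts, fun {i} hi => ?_, ?_⟩) ?_ ?_ ?_
  · rcases Multiset.mem_add.1 hi with h | h
    exacts [hr i h, l.parts_pos h]
  · rw [Multiset.sum_add, l.parts_sum]; omega
  · intro l hl
    simpa [hPQ] using hl
  · intro l _ l' _ h
    exact Nat.Partition.ext (add_left_cancel (congrArg Nat.Partition.parts h))
  · intro l hl
    simp only [Finset.mem_filter, Finset.mem_univ, true_and] at hl
    obtain ⟨s, hs⟩ := Multiset.le_iff_exists_add.1 hl.1
    refine ⟨⟨s, fun {i} hi => l.parts_pos (hs ▸ Multiset.mem_add.2 (Or.inr hi)), ?_⟩, ?_, ?_⟩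
    · have := l.parts_sum
      rw [hs, Multiset.sum_add] at this
      omega
    · simpa [← hPQ, ← hs] using hl.2
    · exact Nat.Partition.ext hs.symm

/-- The number of partitions of `N` having fewer than `w - k` parts larger than `w`. -/
def numFew (k w N : ℕ) : ℕ :=
  (Finset.univ.filter fun l : N.Partition => numGT l.parts w + k < w).card

lemma card_le_count_one {n : ℕ} (k w v : ℕ) (hv : v ≤ n) :
    (Finset.univ.filter fun l : n.Partition =>
      v ≤ l.parts.count 1 ∧ numGT l.parts w + k < w).card = numFew k w (n - v) := by
  rcases Nat.eq_zero_or_pos w with rfl | hw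
  · simp [numFew]
  have h := card_filter_le_parts (n := n) (Multiset.replicate v 1)
    (fun x hx => by rw [Multiset.eq_of_mem_replicate hx]; exact one_pos) (by simpa using hv)
    (fun s => numGT s w + k < w) (fun s => numGT s w + k < w) (fun s => by
      have : numGT (Multiset.replicate v 1) w = 0 :=
        Multiset.countP_eq_zero.2 fun a ha => by
          rw [Multiset.eq_of_mem_replicate ha]; omega
      simp only [numGT, Multiset.countP_add] at this ⊢
      rw [this, zero_add])
  rw [Multiset.sum_replicate, smul_eq_mul, mul_one] at h
  rw [numFew, ← h]
  congr 1
  refine Finset.filter_congr fun l _ => ?_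
  rw [Multiset.le_count_iff_replicate_le]

lemma card_count_one_eq {n : ℕ} (k w : ℕ) :
    ((Finset.univ.filter fun l : n.Partition =>
      l.parts.count 1 = w ∧ numGT l.parts w + k < w).card : ℤ) =
    (Finset.univ.filter fun l : n.Partition =>
      w ≤ l.parts.count 1 ∧ numGT l.parts w + k < w).card -
    (Finset.univ.filter fun l : n.Partition =>
      w + 1 ≤ l.parts.count 1 ∧ numGT l.parts w + k < w).card := by
  rw [eq_sub_iff_add_eq, ← Nat.cast_add, ← Finset.card_union_of_disjoint]
  · congr 2
    ext l
    simp only [Finset.mem_union, Finset.mem_filter, Finset.mem_univ, true_and]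
    omega
  · refine Finset.disjoint_filter.2 fun l _ h => ?_
    omega

lemma count_one_le {n : ℕ} (l : n.Partition) : l.parts.count 1 ≤ n := by
  have h := numGT_eq_count_add l.parts 0
  have := numGT_le l 0
  rw [zero_add] at h
  omega

lemma card_crank_le_eq_sum (k n : ℕ) :
    ((Finset.univ.filter fun l : n.Partition =>
      numGT l.parts (l.parts.count 1) + k < l.parts.count 1).card : ℤ) =
    ∑ w ∈ Finset.range n,
      ((numFew k (w + 1) (n - (w + 1)) : ℤ) - numFew k w (n - (w + 1))) := by
  have h : (Finset.univ.filter fun l : n.Partition =>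
      numGT l.parts (l.parts.count 1) + k < l.parts.count 1).card =
      ∑ w ∈ Finset.range (n + 1), (Finset.univ.filter fun l : n.Partition =>
        l.parts.count 1 = w ∧ numGT l.parts w + k < w).card := by
    rw [Finset.card_eq_sum_card_fiberwise (f := fun l : n.Partition => l.parts.count 1)
      (t := Finset.range (n + 1)) fun l _ => by
        simpa [Nat.lt_succ_iff] using count_one_le l]
    refine Finset.sum_congr rfl fun w _ => ?_
    congr 1
    ext l
    simp only [Finset.mem_filter, Finset.mem_univ, true_and]
    constructor
    · rintro ⟨h, rfl⟩; exact ⟨rfl, h⟩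
    · rintro ⟨rfl, h⟩; exact ⟨h, rfl⟩
  rw [h]
  push_cast
  simp only [card_count_one_eq, Finset.sum_sub_distrib]
  rw [Finset.sum_range_succ', Finset.sum_range_succ (n := n) (f := fun w =>
    ((Finset.univ.filter fun l : n.Partition =>
      w + 1 ≤ l.parts.count 1 ∧ numGT l.parts w + k < w).card : ℤ))]
  have h0 : (Finset.univ.filter fun l : n.Partition =>
      0 ≤ l.parts.count 1 ∧ numGT l.parts 0 + k < 0).card = 0 := by simp
  have hn : (Finset.univ.filter fun l : n.Partition =>
      n + 1 ≤ l.parts.count 1 ∧ numGT l.parts n + k < n).card = 0 := by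
    rw [Finset.card_eq_zero, Finset.filter_eq_empty_iff]
    intro l _ h
    have := count_one_le l
    omega
  rw [h0, hn, Nat.cast_zero, add_zero, add_zero]
  congr 1 <;>
  · refine Finset.sum_congr rfl fun w hw => ?_
    rw [card_le_count_one k _ _ (Finset.mem_range.1 hw)]

lemma numFew_sub (k w n : ℕ) (hw : w < n) :
    (numFew k (w + 1) (n - (w + 1)) : ℤ) - numFew k w (n - (w + 1)) =
    (Finset.univ.filter fun l : n.Partition =>
      numGT l.parts (w + 1) + k < w + 1 ∧ w + 1 ≤ numGT l.parts w + k).card := by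
  have h := card_filter_le_parts (n := n) {w + 1} (by simp) (by simpa using hw)
    (fun s => numGT s (w + 1) + k < w + 1 ∧ w ≤ numGT s w + k)
    (fun s => numGT s (w + 1) + k < w + 1 ∧ w + 1 ≤ numGT s w + k) (fun s => by
      have h1 : numGT ({w + 1} + s) (w + 1) = numGT s (w + 1) := by simp [numGT]
      have h2 : numGT ({w + 1} + s) w = numGT s w + 1 := by simp [numGT]
      rw [h1, h2]; omega)
  have h' : (Finset.univ.filter fun l : n.Partition =>
      numGT l.parts (w + 1) + k < w + 1 ∧ w + 1 ≤ numGT l.parts w + k) =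
      (Finset.univ.filter fun l : n.Partition => {w + 1} ≤ l.parts ∧
        numGT l.parts (w + 1) + k < w + 1 ∧ w + 1 ≤ numGT l.parts w + k) := by
    refine Finset.filter_congr fun l _ => ?_
    rw [Multiset.singleton_le, ← Multiset.count_pos]
    have := numGT_eq_count_add l.parts w
    omega
  rw [h', h, Multiset.sum_singleton, sub_eq_iff_eq_add, ← Nat.cast_add, numFew, numFew,
    ← Finset.card_union_of_disjoint]
  · congr 2
    ext l
    simp only [Finset.mem_union, Finset.mem_filter, Finset.mem_univ, true_and]
    have := numGT_antitone l.parts (Nat.le_succ w)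
    simp only [Nat.succ_eq_add_one] at this
    omega
  · refine Finset.disjoint_filter.2 fun l _ h => ?_
    omega

open Classical in
lemma card_no_fixed_eq_sum (k n : ℕ) :
    (Finset.univ.filter fun l : n.Partition => ∀ j, numGT l.parts j + k ≠ j).card =
    ∑ w ∈ Finset.range n, (Finset.univ.filter fun l : n.Partition =>
      numGT l.parts (w + 1) + k < w + 1 ∧ w + 1 ≤ numGT l.parts w + k).card := by
  rw [← Finset.card_biUnion]
  · congr 1
    ext l
    simp only [Finset.mem_biUnion, Finset.mem_filter, Finset.mem_univ, true_and,
      Finset.mem_range]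
    constructor
    · intro h
      have hex : ∃ w, numGT l.parts w + k < w :=
        ⟨n + k + 1, by have := numGT_le l (n + k + 1); omega⟩
      obtain ⟨w, hw⟩ : ∃ w, Nat.find hex = w + 1 := by
        refine Nat.exists_eq_succ_of_ne_zero fun h0 => ?_
        have := Nat.find_spec hex
        omega
      have h1 := Nat.find_spec hex
      have h2 := Nat.find_min hex (m := w) (by omega)
      rw [hw] at h1
      have h3 := h w
      refine ⟨w, ?_, h1, by omega⟩
      by_contra! hnw
      have h4 := numGT_eq_zero l hnw
      have h5 := numGT_eq_zero l (hnw.trans (Nat.le_succ w))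
      simp only [Nat.succ_eq_add_one] at h5
      omega
    · rintro ⟨w, _, h1, h2⟩ j hj
      rcases le_or_gt j w with hjw | hjw
      · have := numGT_antitone l.parts hjw
        omega
      · have := numGT_antitone l.parts (Nat.succ_le_of_lt hjw)
        simp only [Nat.succ_eq_add_one] at this
        omega
  · intro w _ v _ hwv
    refine Finset.disjoint_filter.2 fun l _ h h' => ?_
    rcases lt_or_gt_of_ne hwv with hlt | hlt <;>
    · have := numGT_antitone l.parts (Nat.succ_le_of_lt hlt)
      simp only [Nat.succ_eq_add_one] at this
      omega

lemma crank_le_neg_iff {n : ℕ} (l : n.Partition) (k : ℕ) :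
    crank l ≤ -(k : ℤ) - 1 ↔ numGT l.parts (l.parts.count 1) + k < l.parts.count 1 := by
  rw [crank, numGT, Multiset.countP_eq_card_filter]
  split_ifs <;> omega

lemma neg_le_crank {n : ℕ} (l : n.Partition) : -(n : ℤ) ≤ crank l := by
  have := count_one_le l
  rw [crank]
  split_ifs <;> omega

lemma M_eq_card {r : ℤ} (hr : r < 0) (n : ℕ) :
    M r n = (Finset.univ.filter fun l : n.Partition => crank l = r).card := by
  rw [M]
  split_ifs with h1 h2 h3
  · omega
  · subst h1
    obtain rfl : r = -1 := by omega
    have h (l : (1 : ℕ).Partition) : crank l = -1 := by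
      simp [crank, Nat.Partition.partition_one_parts]
    simp [h]
  · subst h1
    symm
    rw [Nat.cast_eq_zero, Finset.card_eq_zero, Finset.filter_eq_empty_iff]
    intro l _ h
    have := neg_le_crank l
    push_cast at this
    omega
  · rw [Nat.card_eq_fintype_card, Fintype.card_subtype]

lemma Mle_eq_card {m : ℤ} (hm : m < 0) (n : ℕ) :
    Mle m n = (Finset.univ.filter fun l : n.Partition => crank l ≤ m).card := by
  rw [Finset.card_eq_sum_card_fiberwise (f := crank) (t := Finset.Icc (-(n : ℤ)) m)
    fun l hl => by simpa [neg_le_crank] using hl, Mle, Nat.cast_sum]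
  refine Finset.sum_congr rfl fun r hr => ?_
  rw [Finset.mem_Icc] at hr
  rw [M_eq_card (by omega), Finset.filter_filter]
  congr 2
  refine Finset.filter_congr fun l _ => ?_
  omega

end RankCrank

open RankCrank in
/-- For every negative integer `m` and every `n ≥ 1`, `M(≤ m, n) = p(n) - q(-m-1, n)`. -/
theorem Mle_eq_p_sub_q (m : ℤ) (hm : m < 0) (n : ℕ) (hn : 1 ≤ n) :
    Mle m n = (p n : ℤ) - (q (-m - 1) n : ℤ) := by
  obtain ⟨k, rfl⟩ : ∃ k : ℕ, m = -(k : ℤ) - 1 := ⟨(-m - 1).toNat, by omega⟩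
  have hk : -(-(k : ℤ) - 1) - 1 = k := by ring
  rw [hk, Mle_eq_card hm, ← q_add_card k n, card_no_fixed_eq_sum]
  simp only [crank_le_neg_iff]
  rw [card_crank_le_eq_sum, Finset.sum_congr rfl fun w hw =>
    numFew_sub k w n (Finset.mem_range.1 hw)]
  push_cast
  ring
end
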